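/- arXiv:2211.01498 — 4 statements merged into one kernel-verified Lean document; each statement's English description precedes it below -/
import Mathlib

section
/- Let d be a positive integer, let X_1, …, X_d be sets, and for each j let S_j ⊆ X_j be nonempty and f_j : X_j → ℝ attain a maximum value M_j and a minimum value m_j on S_j. Let S = ∏_{j=1}^d S_j, let g : ℝ → ℝ be a strictly increasing bijection with inverse g⁻¹, let y0 ∈ ℝ, let D : ℝ × ℝ → ℝ satisfy the monotone-deviation assumption, and define f(x) = g⁻¹(∑_{j=1}^d f_j(x_j)). Then sup_{x ∈ S} D(f(x), y0) = max(D(g⁻¹(∑_{j=1}^d M_j), y0), D(g⁻¹(∑_{j=1}^d m_j), y0)). -/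
/-- A function that is antitone up to `t` and monotone from `t` on is bounded on `[a, b]` by its
larger endpoint value. -/
theorem le_max_of_antitoneOn_Iic_of_monotoneOn_Ici {α β : Type*} [LinearOrder α] [LinearOrder β]
    {φ : α → β} {t a b y : α} (hanti : AntitoneOn φ (Set.Iic t)) (hmono : MonotoneOn φ (Set.Ici t))
    (hay : a ≤ y) (hyb : y ≤ b) : φ y ≤ max (φ b) (φ a) := by
  rcases le_total t y with hty | hyt
  · exact le_max_of_le_left (hmono hty (hty.trans hyb) hyb)
  · exact le_max_of_le_right (hanti (hay.trans hyt) hyt hay)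

/-- For a generalized additive model `f(x) = g⁻¹(∑ j, f_j (x j))` on a Cartesian
product `S = ∏ S_j`, with each `f_j` attaining maximum `M j` and minimum `m j` on `S_j`, and a
monotone-deviation function `D`,
`sup_{x ∈ S} D (f x) y0 = max (D (g⁻¹ (∑ M j)) y0) (D (g⁻¹ (∑ m j)) y0)`. -/
theorem stmt_3 {d : ℕ} (hd : 0 < d) (X : Fin d → Type*)
    (S : ∀ j, Set (X j)) (f : ∀ j, X j → ℝ) (M m : Fin d → ℝ)
    (hM : ∀ j, IsGreatest ((f j) '' (S j)) (M j))
    (hm : ∀ j, IsLeast ((f j) '' (S j)) (m j))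
    (g ginv : ℝ → ℝ) (hg : StrictMono g)
    (hgl : Function.LeftInverse ginv g) (hgr : Function.RightInverse ginv g)
    (y0 : ℝ) (D : ℝ → ℝ → ℝ)
    (hD0 : ∀ t : ℝ, D t t = 0)
    (hDmono : ∀ t : ℝ, MonotoneOn (fun u => D u t) (Set.Ici t))
    (hDanti : ∀ t : ℝ, AntitoneOn (fun u => D u t) (Set.Iic t)) :
    sSup {z | ∃ x ∈ Set.univ.pi S, z = D (ginv (∑ j, f j (x j))) y0} =
      max (D (ginv (∑ j, M j)) y0) (D (ginv (∑ j, m j)) y0) := by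
  have hginv : Monotone ginv := fun a b hab => by
    rw [← hg.le_iff_le, hgr a, hgr b]
    exact hab
  choose xM hxM hfM using fun j => (hM j).1
  choose xm hxm hfm using fun j => (hm j).1
  refine IsGreatest.csSup_eq ⟨?_, ?_⟩
  · rcases max_choice (D (ginv (∑ j, M j)) y0) (D (ginv (∑ j, m j)) y0) with h | h
    · exact ⟨xM, fun j _ => hxM j, by simp only [h, hfM]⟩
    · exact ⟨xm, fun j _ => hxm j, by simp only [h, hfm]⟩
  · rintro _ ⟨x, hx, rfl⟩
    have hmem : ∀ j, f j (x j) ∈ f j '' S j := fun j => Set.mem_image_of_mem _ (hx j trivial)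
    exact le_max_of_antitoneOn_Iic_of_monotoneOn_Ici (hDanti y0) (hDmono y0)
      (hginv (Finset.sum_le_sum fun j _ => (hm j).2 (hmem j)))
      (hginv (Finset.sum_le_sum fun j _ => (hM j).2 (hmem j)))
end

section
/- Let 𝒳 be a set and C ⊆ 𝒳. Let f0 : 𝒳 → ℝ be piecewise constant over a finite partition {L_{0,1}, …, L_{0,L0}} of 𝒳 with values y_{0,1}, …, y_{0,L0}. Let D : ℝ × ℝ → ℝ satisfy the monotone-deviation assumption, let g : ℝ → ℝ be a strictly increasing bijection with inverse g⁻¹, let h : 𝒳 → ℝ, and set f = g⁻¹ ∘ h. Suppose C is nonempty and, for each m with C ∩ L_{0,m} ≠ ∅, h attains its maximum on C ∩ L_{0,m} at a point x_m⁺ and its minimum at a point x_m⁻. Then sup_{x ∈ C} D(f(x), f0(x)) = max over all m with C ∩ L_{0,m} ≠ ∅ of max(D(g⁻¹(h(x_m⁺)), y_{0,m}), D(g⁻¹(h(x_m⁻)), y_{0,m})). -/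
/-- A function that is antitone up to `t` and monotone from `t` on is bounded on an interval by the
larger of its values at the endpoints. -/
theorem le_max_of_antitoneOn_of_monotoneOn {α β : Type*} [LinearOrder α] [LinearOrder β]
    {φ : α → β} {t a b u : α} (hanti : AntitoneOn φ (Set.Iic t)) (hmono : MonotoneOn φ (Set.Ici t))
    (hau : a ≤ u) (hub : u ≤ b) : φ u ≤ max (φ b) (φ a) := by
  rcases le_total t u with htu | hut
  · exact le_max_of_le_left (hmono htu (htu.trans hub) hub)
  · exact le_max_of_le_right (hanti (hau.trans hut) hut hau)

/-- With `f0` piecewise constant over a finite partition, `f = g⁻¹ ∘ h` with `g`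
a strictly increasing bijection, `D` a monotone-deviation function, and `h` attaining its
maximum at `xp m` and minimum at `xm m` on each nonempty `C ∩ L_{0,m}`, the supremum of
`D (f x) (f0 x)` over `C` equals the maximum over all such `m` of
`max (D (g⁻¹ (h (xp m))) (y0 m)) (D (g⁻¹ (h (xm m))) (y0 m))`. -/
theorem stmt_6 {X : Type*} (C : Set X) (hC : C.Nonempty) {L0 : ℕ}
    (P0 : Fin L0 → Set X)
    (hdisj : ∀ m m', m ≠ m' → P0 m ∩ P0 m' = ∅)
    (hcov : (⋃ m, P0 m) = Set.univ)
    (f0 : X → ℝ) (y0 : Fin L0 → ℝ)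
    (hf0 : ∀ m, ∀ x ∈ P0 m, f0 x = y0 m)
    (D : ℝ → ℝ → ℝ)
    (hD0 : ∀ t : ℝ, D t t = 0)
    (hDmono : ∀ t : ℝ, MonotoneOn (fun u => D u t) (Set.Ici t))
    (hDanti : ∀ t : ℝ, AntitoneOn (fun u => D u t) (Set.Iic t))
    (g ginv : ℝ → ℝ) (hg : StrictMono g)
    (hgl : Function.LeftInverse ginv g) (hgr : Function.RightInverse ginv g)
    (h : X → ℝ) (xp xm : Fin L0 → X)
    (hxp : ∀ m, (C ∩ P0 m).Nonempty →
      xp m ∈ C ∩ P0 m ∧ ∀ x ∈ C ∩ P0 m, h x ≤ h (xp m))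
    (hxm : ∀ m, (C ∩ P0 m).Nonempty →
      xm m ∈ C ∩ P0 m ∧ ∀ x ∈ C ∩ P0 m, h (xm m) ≤ h x) :
    IsGreatest
      {z | ∃ m, (C ∩ P0 m).Nonempty ∧
        z = max (D (ginv (h (xp m))) (y0 m)) (D (ginv (h (xm m))) (y0 m))}
      (sSup {z | ∃ x ∈ C, z = D (ginv (h x)) (f0 x)}) := by
  have hginv : Monotone ginv := fun a b hab => by
    rwa [← hg.le_iff_le, hgr a, hgr b]
  have hcell : ∀ x, ∃ m, x ∈ P0 m := fun x => by
    exact Set.mem_iUnion.mp (hcov.ge (Set.mem_univ x))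
  set T : Set ℝ := {z | ∃ m, (C ∩ P0 m).Nonempty ∧
    z = max (D (ginv (h (xp m))) (y0 m)) (D (ginv (h (xm m))) (y0 m))}
  have hfin : T.Finite :=
    (Set.finite_range fun m =>
      max (D (ginv (h (xp m))) (y0 m)) (D (ginv (h (xm m))) (y0 m))).subset <| by
        rintro z ⟨m, -, rfl⟩
        exact ⟨m, rfl⟩
  have hne : T.Nonempty := by
    obtain ⟨x, hx⟩ := hC
    obtain ⟨m, hm⟩ := hcell x
    exact ⟨_, m, ⟨x, hx, hm⟩, rfl⟩
  obtain ⟨M, hMT, hMmax⟩ := hfin.exists_maximal hne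
  have hMub : M ∈ upperBounds T := fun z hz => (le_total z M).elim id (hMmax hz)
  have hS : IsGreatest {z | ∃ x ∈ C, z = D (ginv (h x)) (f0 x)} M := by
    constructor
    · obtain ⟨m, hm, rfl⟩ := hMT
      obtain ⟨⟨hpC, hpP⟩, -⟩ := hxp m hm
      obtain ⟨⟨hmC, hmP⟩, -⟩ := hxm m hm
      rcases max_choice (D (ginv (h (xp m))) (y0 m)) (D (ginv (h (xm m))) (y0 m)) with e | e
      · exact ⟨xp m, hpC, by rw [e, hf0 m _ hpP]⟩
      · exact ⟨xm m, hmC, by rw [e, hf0 m _ hmP]⟩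
    · rintro z ⟨x, hx, rfl⟩
      obtain ⟨m, hm⟩ := hcell x
      have hn : (C ∩ P0 m).Nonempty := ⟨x, hx, hm⟩
      rw [hf0 m x hm]
      exact (le_max_of_antitoneOn_of_monotoneOn (hDanti (y0 m)) (hDmono (y0 m))
        (hginv ((hxm m hn).2 x ⟨hx, hm⟩)) (hginv ((hxp m hn).2 x ⟨hx, hm⟩))).trans
        (hMub ⟨m, hn, rfl⟩)
  rw [hS.csSup_eq]
  exact ⟨hMT, hMub⟩
end

section
/- Let 𝒳 be a set, C ⊆ 𝒳 nonempty, and f, f0 : 𝒳 → ℝ. Let D̃ : ℝ → ℝ satisfy D̃(0) = 0, D̃ monotonically nondecreasing on [0, ∞) and monotonically nonincreasing on (−∞, 0], and define D(y, y0) = D̃(y − y0). Suppose the difference Δ = f − f0 attains its maximum on C at a point x⁺ and its minimum on C at a point x⁻. Then sup_{x ∈ C} D(f(x), f0(x)) = max(D̃(Δ(x⁺)), D̃(Δ(x⁻))). -/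
/-- If `D(y, y0) = D̃(y - y0)` with `D̃(0) = 0`, `D̃` nondecreasing on `[0, ∞)`
and nonincreasing on `(-∞, 0]`, and the difference `Δ = f - f0` attains its maximum on `C` at
`xp` and its minimum at `xm`, then
`sup_{x ∈ C} D(f x, f0 x) = max (D̃ (Δ xp)) (D̃ (Δ xm))`. -/
theorem stmt_7 {X : Type*} (C : Set X) (hC : C.Nonempty) (f f0 : X → ℝ)
    (Dt : ℝ → ℝ) (hD0 : Dt 0 = 0)
    (hmono : MonotoneOn Dt (Set.Ici (0 : ℝ)))
    (hanti : AntitoneOn Dt (Set.Iic (0 : ℝ)))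
    (xp xm : X) (hxp : xp ∈ C) (hxm : xm ∈ C)
    (hub : ∀ x ∈ C, f x - f0 x ≤ f xp - f0 xp)
    (hlb : ∀ x ∈ C, f xm - f0 xm ≤ f x - f0 x) :
    sSup {z | ∃ x ∈ C, z = Dt (f x - f0 x)} =
      max (Dt (f xp - f0 xp)) (Dt (f xm - f0 xm)) := by
  refine IsGreatest.csSup_eq ⟨?_, ?_⟩
  · rcases max_choice (Dt (f xp - f0 xp)) (Dt (f xm - f0 xm)) with h | h
    · exact ⟨xp, hxp, h⟩
    · exact ⟨xm, hxm, h⟩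
  · rintro _ ⟨x, hx, rfl⟩
    rcases le_total 0 (f x - f0 x) with h | h
    · exact le_max_of_le_left (hmono h (h.trans (hub x hx)) (hub x hx))
    · exact le_max_of_le_right (hanti ((hlb x hx).trans h) h (hlb x hx))
end

section
/- Let d and K be positive integers. For each k ∈ {1, …, K}, let f_k : ℝ^d → ℝ be piecewise constant over a finite partition of ℝ^d into axis-aligned boxes {L_{1,k}, …, L_{L_k,k}} with values y_{1,k}, …, y_{L_k,k}, and let f0 : ℝ^d → ℝ be piecewise constant over a finite partition of ℝ^d into axis-aligned boxes {L_{0,1}, …, L_{0,L0}} with values y_{0,1}, …, y_{0,L0}. Define the ensemble f(x) = ∑_{k=1}^K f_k(x), and let D : ℝ × ℝ → ℝ be any function. Then sup_{x ∈ ℝ^d} D(f(x), f0(x)) = max over all tuples (l_1, …, l_K, m) of leaf indices whose leaves L_{l_1,1}, …, L_{l_K,K}, L_{0,m} pairwise intersect, of D(∑_{k=1}^K y_{l_k,k}, y_{0,m}). -/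
/-- **Helly's theorem on the line**: finitely many pairwise intersecting order-convex sets
have a common point. -/
theorem exists_mem_forall_of_pairwise_inter_nonempty {ι α : Type*} [Finite ι] [Nonempty ι]
    [LinearOrder α] {I : ι → Set α} (hI : ∀ i, (I i).OrdConnected)
    (hinter : ∀ i j, (I i ∩ I j).Nonempty) : ∃ x, ∀ i, x ∈ I i := by
  choose p hp using hinter
  choose a ha using fun i => Finite.exists_min (p i)
  obtain ⟨i₀, hi₀⟩ := Finite.exists_max fun i => p i (a i)
  exact ⟨p i₀ (a i₀), fun i =>
    (hI i).out (hp i (a i)).1 (hp i₀ i).2 ⟨hi₀ i, ha i₀ i⟩⟩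

/-- Finitely many pairwise intersecting axis-aligned boxes have a common point. -/
theorem exists_mem_forall_box_of_pairwise_inter_nonempty {ι κ α : Type*} [Finite ι] [Nonempty ι]
    [LinearOrder α] {B : ι → Set (κ → α)}
    (hB : ∀ i, ∃ I : κ → Set α, (∀ j, (I j).OrdConnected) ∧ B i = Set.univ.pi I)
    (hinter : ∀ i j, (B i ∩ B j).Nonempty) : ∃ x, ∀ i, x ∈ B i := by
  choose I hI hBI using hB
  have hcoord : ∀ j, ∃ t, ∀ i, t ∈ I i j := fun j =>
    exists_mem_forall_of_pairwise_inter_nonempty (fun i => hI i j) fun i i' => by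
      obtain ⟨x, hx, hx'⟩ := hinter i i'
      rw [hBI] at hx hx'
      exact ⟨x j, hx j trivial, hx' j trivial⟩
  choose x hx using hcoord
  exact ⟨x, fun i => by rw [hBI]; exact fun j _ => hx j i⟩

/-- For a tree ensemble `f = ∑ k, f_k` of piecewise constant functions over
axis-aligned box partitions of ℝ^d and a reference tree `f0`, and any deviation function `D`,
the supremum of `D (f x) (f0 x)` over ℝ^d equals the maximum of
`D (∑ k, y_{ℓ k, k}) (y_{0,m})` over tuples of leaves that pairwise intersect
((K+1)-cliques of the intersection graph). -/
theorem stmt_11 {d K : ℕ} (hd : 0 < d) (hK : 0 < K)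
    (L : Fin K → ℕ) (L0 : ℕ)
    (P : ∀ k : Fin K, Fin (L k) → Set (Fin d → ℝ))
    (P0 : Fin L0 → Set (Fin d → ℝ))
    (hbox : ∀ k l, ∃ I : Fin d → Set ℝ,
      (∀ j, (I j).OrdConnected) ∧ P k l = Set.univ.pi I)
    (hbox0 : ∀ m, ∃ I : Fin d → Set ℝ,
      (∀ j, (I j).OrdConnected) ∧ P0 m = Set.univ.pi I)
    (hdisj : ∀ k, ∀ l l', l ≠ l' → P k l ∩ P k l' = ∅)
    (hcov : ∀ k, (⋃ l, P k l) = Set.univ)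
    (hdisj0 : ∀ m m', m ≠ m' → P0 m ∩ P0 m' = ∅)
    (hcov0 : (⋃ m, P0 m) = Set.univ)
    (fk : Fin K → (Fin d → ℝ) → ℝ) (f0 : (Fin d → ℝ) → ℝ)
    (y : ∀ k : Fin K, Fin (L k) → ℝ) (y0 : Fin L0 → ℝ)
    (hfk : ∀ k l, ∀ x ∈ P k l, fk k x = y k l)
    (hf0 : ∀ m, ∀ x ∈ P0 m, f0 x = y0 m)
    (D : ℝ → ℝ → ℝ) :
    IsGreatest
      {z | ∃ (ℓ : ∀ k : Fin K, Fin (L k)) (m : Fin L0),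
        (∀ k k', k ≠ k' → (P k (ℓ k) ∩ P k' (ℓ k')).Nonempty) ∧
        (∀ k, (P k (ℓ k) ∩ P0 m).Nonempty) ∧
        z = D (∑ k, y k (ℓ k)) (y0 m)}
      (sSup {z | ∃ x : Fin d → ℝ, z = D (∑ k, fk k x) (f0 x)}) := by
  have hset : {z | ∃ x : Fin d → ℝ, z = D (∑ k, fk k x) (f0 x)} =
      {z | ∃ (ℓ : ∀ k : Fin K, Fin (L k)) (m : Fin L0),
        (∀ k k', k ≠ k' → (P k (ℓ k) ∩ P k' (ℓ k')).Nonempty) ∧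
        (∀ k, (P k (ℓ k) ∩ P0 m).Nonempty) ∧
        z = D (∑ k, y k (ℓ k)) (y0 m)} := by
    ext z
    constructor
    · rintro ⟨x, rfl⟩
      have hx : ∀ k, ∃ l, x ∈ P k l := fun k => Set.mem_iUnion.1 (hcov k ▸ Set.mem_univ x)
      choose ℓ hℓ using hx
      obtain ⟨m, hm⟩ := Set.mem_iUnion.1 (hcov0 ▸ Set.mem_univ x)
      refine ⟨ℓ, m, fun k k' _ => ⟨x, hℓ k, hℓ k'⟩, fun k => ⟨x, hℓ k, hm⟩, ?_⟩
      simp only [hf0 m x hm, fun k => hfk k (ℓ k) x (hℓ k)]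
    · rintro ⟨ℓ, m, hP, hP0, rfl⟩
      obtain ⟨x, hx⟩ := exists_mem_forall_box_of_pairwise_inter_nonempty
        (B := fun o : Option (Fin K) => o.elim (P0 m) fun k => P k (ℓ k))
        (by rintro (_ | k); exacts [hbox0 m, hbox k (ℓ k)])
        (by
          rintro (_ | k) (_ | k')
          · simpa using (hP0 ⟨0, hK⟩).mono Set.inter_subset_right
          · simpa [Set.inter_comm] using hP0 k'
          · exact hP0 k
          · rcases eq_or_ne k k' with rfl | hne
            · simpa using (hP0 k).mono Set.inter_subset_left
            · exact hP k k' hne)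
      refine ⟨x, ?_⟩
      simp only [hf0 m x (hx none), fun k => hfk k (ℓ k) x (hx (some k))]
  rw [← hset]
  have hne : {z | ∃ x : Fin d → ℝ, z = D (∑ k, fk k x) (f0 x)}.Nonempty := ⟨_, 0, rfl⟩
  have hfin : {z | ∃ x : Fin d → ℝ, z = D (∑ k, fk k x) (f0 x)}.Finite := by
    rw [hset]
    refine (Set.finite_range fun q : (∀ k, Fin (L k)) × Fin L0 =>
      D (∑ k, y k (q.1 k)) (y0 q.2)).subset ?_
    rintro z ⟨ℓ, m, -, -, rfl⟩
    exact ⟨(ℓ, m), rfl⟩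
  exact ⟨hne.csSup_mem hfin, fun z hz => le_csSup hfin.bddAbove hz⟩
end
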